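/- arXiv:2401.12661 — 2 statements merged into one kernel-verified Lean document; each statement's English description precedes it below -/
import Mathlib

section
/- Fix an integer G ≥ 1 and positive reals k_on, k_off, k_1, …, k_G, δ, δ_1 with δ ≠ δ_1, and let α = (k_on + k_off)/(k_on k_1) + Σ_{i=2}^G 1/k_i. Let s_1, …, s_M be pairwise distinct nonzero complex numbers with positive real part, none equal to δ or δ_1, let A_1, …, A_M be complex numbers, and set R(x) = x/α − Σ_{r=1}^M A_r (1 − e^{−s_r x}). Let H(t) = 1 − (δ/(δ−δ_1)) e^{−δ_1 t} + (δ_1/(δ−δ_1)) e^{−δ t}, B_1^* = (1/α)∫_0^∞ (1 − H(t)) dt, B_1(t) = ∫_0^t R'(x)(1 − H(t−x)) dx, B_2^* = (1/α)∫_0^∞ B_1(t)(1 − H(t)) dt, and FF = 1 + 2 B_2^*/B_1^* − B_1^*. Then B_1^* = (1/α)(1/δ + 1/δ_1) and FF = 1 − Σ_{r=1}^M A_r · [s_r (δ + δ_1)³ + s_r² (δ² + 3δδ_1 + δ_1²)] / [(δ + δ_1)² (δ + s_r)(δ_1 + s_r)]. -/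
open Complex MeasureTheory Set

lemma aux_int (c : ℂ) (hc : 0 < c.re) :
    IntegrableOn (fun t : ℝ => Complex.exp (-(c * (t:ℂ)))) (Ioi 0) ∧
      ∫ t in Ioi (0:ℝ), Complex.exp (-(c * (t:ℂ))) = 1 / c := by
  have h1 : (-c).re < 0 := by simpa using hc
  have h := integrableOn_exp_mul_complex_Ioi h1 0
  have h2 := integral_exp_mul_complex_Ioi h1 0
  simp only [neg_mul] at h h2
  refine ⟨h, ?_⟩
  rw [h2]
  simp

lemma aux_conv (s d : ℂ) (h : s ≠ d) (t : ℝ) :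
    ∫ x in (0:ℝ)..t, Complex.exp (-(s * (x:ℂ))) * Complex.exp (-(d * ((t - x : ℝ):ℂ))) =
      (Complex.exp (-(s * (t:ℂ))) - Complex.exp (-(d * (t:ℂ)))) / (d - s) := by
  have hd : d - s ≠ 0 := sub_ne_zero.mpr h.symm
  have e : ∀ x : ℝ, Complex.exp (-(s * (x:ℂ))) * Complex.exp (-(d * ((t - x : ℝ):ℂ))) =
      Complex.exp (-(d * (t:ℂ))) * Complex.exp ((d - s) * (x:ℂ)) := by
    intro x
    rw [← Complex.exp_add, ← Complex.exp_add]
    congr 1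
    push_cast
    ring
  simp_rw [e]
  rw [intervalIntegral.integral_const_mul, integral_exp_mul_complex hd, mul_div_assoc', mul_sub,
    ← Complex.exp_add]
  have : -(d * (t:ℂ)) + (d - s) * (t:ℂ) = -(s * (t:ℂ)) := by ring
  rw [this]
  simp

/-- survival function -/
noncomputable def SS (d e : ℂ) (t : ℝ) : ℂ :=
  d / (d - e) * Complex.exp (-(e * (t:ℂ))) - e / (d - e) * Complex.exp (-(d * (t:ℂ)))

lemma SS_cont (d e : ℂ) : Continuous (SS d e) := by
  unfold SS
  fun_prop

lemma aux_J (d e s : ℂ) (hsd : s ≠ d) (hse : s ≠ e) (t : ℝ) :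
    ∫ x in (0:ℝ)..t, Complex.exp (-(s * (x:ℂ))) * SS d e (t - x) =
      d / (d - e) * ((Complex.exp (-(s * (t:ℂ))) - Complex.exp (-(e * (t:ℂ)))) / (e - s)) -
      e / (d - e) * ((Complex.exp (-(s * (t:ℂ))) - Complex.exp (-(d * (t:ℂ)))) / (d - s)) := by
  rw [← aux_conv s d hsd, ← aux_conv s e hse, ← intervalIntegral.integral_const_mul,
    ← intervalIntegral.integral_const_mul, ← intervalIntegral.integral_sub]
  · congr 1
    ext x
    unfold SS
    ring
  · apply Continuous.intervalIntegrable
    fun_prop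
  · apply Continuous.intervalIntegrable
    fun_prop

lemma aux_K (d e s : ℂ) (hd : 0 < d.re) (he : 0 < e.re) (hs : 0 ≤ s.re) (hde : d ≠ e)
    (hsd : s ≠ d) (hse : s ≠ e) :
    IntegrableOn (fun t : ℝ =>
      (∫ x in (0:ℝ)..t, Complex.exp (-(s * (x:ℂ))) * SS d e (t - x)) * SS d e t) (Ioi 0) ∧
    ∫ t in Ioi (0:ℝ), (∫ x in (0:ℝ)..t, Complex.exp (-(s * (x:ℂ))) * SS d e (t - x)) * SS d e t
      = (d + e) / (d * e) * ((d + e) ^ 3 + s * (d ^ 2 + 3 * d * e + e ^ 2)) /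
        (2 * ((d + e) ^ 2 * (d + s) * (e + s))) := by
  have n (c : ℂ) (hc : 0 < c.re) : c ≠ 0 := by
    rintro rfl
    simp at hc
  have hse' : 0 < (e + s).re := by simp; linarith
  have hsd' : 0 < (d + s).re := by simp; linarith
  have hee : 0 < (e + e).re := by simp; linarith
  have hdd : 0 < (d + d).re := by simp; linarith
  have hdep : 0 < (d + e).re := by simp; linarith
  obtain ⟨i1, v1⟩ := aux_int _ hse'
  obtain ⟨i2, v2⟩ := aux_int _ hsd'
  obtain ⟨i3, v3⟩ := aux_int _ hee
  obtain ⟨i4, v4⟩ := aux_int _ hdd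
  obtain ⟨i5, v5⟩ := aux_int _ hdep
  have n1 := n _ hse'
  have n2 := n _ hsd'
  have n5 := n _ hdep
  have n6 := n _ hd
  have n7 := n _ he
  have m1 : d - e ≠ 0 := sub_ne_zero.mpr hde
  have m2 : d - s ≠ 0 := sub_ne_zero.mpr hsd.symm
  have m3 : e - s ≠ 0 := sub_ne_zero.mpr hse.symm
  have key : ∀ t : ℝ,
      (∫ x in (0:ℝ)..t, Complex.exp (-(s * (x:ℂ))) * SS d e (t - x)) * SS d e t =
      (d / (d - e) * (d / (d - e) / (e - s) - e / (d - e) / (d - s))) *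
        Complex.exp (-((e + s) * (t:ℂ))) +
      (-(e / (d - e) * (d / (d - e) / (e - s) - e / (d - e) / (d - s)))) *
        Complex.exp (-((d + s) * (t:ℂ))) +
      (-(d / (d - e) * (d / (d - e) / (e - s)))) * Complex.exp (-((e + e) * (t:ℂ))) +
      (-(e / (d - e) * (e / (d - e) / (d - s)))) * Complex.exp (-((d + d) * (t:ℂ))) +
      (d / (d - e) * (e / (d - e) / (e - s)) + d / (d - e) * (e / (d - e) / (d - s))) *
        Complex.exp (-((d + e) * (t:ℂ))) := by
    intro t
    rw [aux_J d e s hsd hse]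
    unfold SS
    simp only [add_mul, neg_add, Complex.exp_add]
    ring
  have j1 := i1.const_mul (d / (d - e) * (d / (d - e) / (e - s) - e / (d - e) / (d - s)))
  have j2 := i2.const_mul (-(e / (d - e) * (d / (d - e) / (e - s) - e / (d - e) / (d - s))))
  have j3 := i3.const_mul (-(d / (d - e) * (d / (d - e) / (e - s))))
  have j4 := i4.const_mul (-(e / (d - e) * (e / (d - e) / (d - s))))
  have j5 := i5.const_mul
    (d / (d - e) * (e / (d - e) / (e - s)) + d / (d - e) * (e / (d - e) / (d - s)))
  simp_rw [key]
  refine ⟨(((j1.add j2).add j3).add j4).add j5, ?_⟩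
  rw [integral_add (((j1.fun_add j2).fun_add j3).fun_add j4) j5,
    integral_add ((j1.fun_add j2).fun_add j3) j4, integral_add (j1.fun_add j2) j3, integral_add j1 j2]
  simp only [integral_const_mul, v1, v2, v3, v4, v5]
  rw [← two_mul, ← two_mul]
  field_simp
  ring

/-- Fano factor of total nuclear mRNA for `S = 2` nuclear
processing stages (service time a sum of two exponentials with rates `δ`
and `δ₁`). -/
theorem fano_factor_nuclear_S2
    (G : ℕ) (hG : 1 ≤ G) (kon koff δ δ₁ : ℝ) (k : ℕ → ℝ)
    (hkon : 0 < kon) (hkoff : 0 < koff) (hδ : 0 < δ) (hδ₁ : 0 < δ₁) (hδne : δ ≠ δ₁)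
    (hk : ∀ i ∈ Finset.Icc 1 G, 0 < k i)
    (α : ℝ) (hα : α = (kon + koff) / (kon * k 1) + ∑ i ∈ Finset.Icc 2 G, 1 / k i)
    (M : ℕ) (sr : Fin M → ℂ) (A : Fin M → ℂ)
    (hdist : Function.Injective sr) (hne0 : ∀ r, sr r ≠ 0)
    (hre : ∀ r, 0 < (sr r).re)
    (hneδ : ∀ r, sr r ≠ (δ : ℂ)) (hneδ₁ : ∀ r, sr r ≠ (δ₁ : ℂ))
    (R : ℝ → ℂ)
    (hR : ∀ x : ℝ, R x = ((x / α : ℝ) : ℂ) -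
      ∑ r : Fin M, A r * (1 - Complex.exp (-(sr r * (x : ℂ)))))
    (H : ℝ → ℝ)
    (hH : ∀ t : ℝ, H t = 1 - (δ / (δ - δ₁)) * Real.exp (-(δ₁ * t))
      + (δ₁ / (δ - δ₁)) * Real.exp (-(δ * t)))
    (B1s : ℝ) (hB1s : B1s = (1 / α) * ∫ t in Ioi (0 : ℝ), (1 - H t))
    (B1 : ℝ → ℂ)
    (hB1 : ∀ t : ℝ, B1 t = ∫ x in (0 : ℝ)..t, deriv R x * (((1 : ℝ) - H (t - x) : ℝ) : ℂ))
    (B2s : ℂ)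
    (hB2s : B2s = (1 / (α : ℂ)) * ∫ t in Ioi (0 : ℝ), B1 t * (((1 : ℝ) - H t : ℝ) : ℂ))
    (FF : ℂ) (hFF : FF = 1 + 2 * B2s / (B1s : ℂ) - (B1s : ℂ)) :
    B1s = (1 / α) * (1 / δ + 1 / δ₁) ∧
      FF = 1 - ∑ r : Fin M, A r *
        (sr r * ((δ : ℂ) + (δ₁ : ℂ)) ^ 3 +
          sr r ^ 2 * ((δ : ℂ) ^ 2 + 3 * (δ : ℂ) * (δ₁ : ℂ) + (δ₁ : ℂ) ^ 2)) /
        (((δ : ℂ) + (δ₁ : ℂ)) ^ 2 * ((δ : ℂ) + sr r) * ((δ₁ : ℂ) + sr r)) := by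
  have hdc : (0:ℝ) < (δ:ℂ).re := by simpa using hδ
  have hec : (0:ℝ) < (δ₁:ℂ).re := by simpa using hδ₁
  have hdn : (δ:ℂ) ≠ 0 := by exact_mod_cast hδ.ne'
  have hen : (δ₁:ℂ) ≠ 0 := by exact_mod_cast hδ₁.ne'
  have hsumn : (δ:ℂ) + (δ₁:ℂ) ≠ 0 := by exact_mod_cast (add_pos hδ hδ₁).ne'
  have hdec : (δ:ℂ) ≠ (δ₁:ℂ) := by exact_mod_cast hδne
  have hαpos : 0 < α := by
    rw [hα]
    have h1 : 0 < k 1 := hk 1 (by simp [hG])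
    have h2 : 0 ≤ ∑ i ∈ Finset.Icc 2 G, 1 / k i := by
      apply Finset.sum_nonneg
      intro i hi
      rw [Finset.mem_Icc] at hi
      have := hk i (by rw [Finset.mem_Icc]; omega)
      positivity
    positivity
  have hαn : (α:ℂ) ≠ 0 := by exact_mod_cast hαpos.ne'
  have hS : ∀ t : ℝ, (((1 : ℝ) - H t : ℝ) : ℂ) = SS δ δ₁ t := by
    intro t
    rw [hH]
    unfold SS
    push_cast
    ring
  have hm : ((∫ t in Ioi (0 : ℝ), (1 - H t) : ℝ) : ℂ) = 1 / δ + 1 / δ₁ := by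
    rw [← integral_complex_ofReal]
    obtain ⟨i1, v1⟩ := aux_int _ hdc
    obtain ⟨i2, v2⟩ := aux_int _ hec
    simp_rw [hS]
    unfold SS
    rw [integral_sub (i2.const_mul _) (i1.const_mul _)]
    simp only [integral_const_mul, v1, v2]
    have m1 : (δ:ℂ) - δ₁ ≠ 0 := sub_ne_zero.mpr hdec
    field_simp
    ring
  have hB : B1s = (1 / α) * (1 / δ + 1 / δ₁) := by
    rw [hB1s]
    congr 1
    exact_mod_cast hm
  refine ⟨hB, ?_⟩
  have hderiv : ∀ x : ℝ, deriv R x =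
      1 / (α:ℂ) - ∑ r : Fin M, A r * sr r * Complex.exp (-(sr r * (x:ℂ))) := by
    intro x
    have hRe : R = fun x : ℝ => ((x:ℂ) / α) -
      ∑ r : Fin M, A r * (1 - Complex.exp (-(sr r * (x : ℂ)))) := by
      ext x
      rw [hR]
      push_cast
      rfl
    rw [hRe]
    apply HasDerivAt.deriv
    have hx : HasDerivAt (fun x : ℝ => (x:ℂ)) 1 x := Complex.ofRealCLM.hasDerivAt
    apply HasDerivAt.sub
    · exact hx.div_const _
    · apply HasDerivAt.fun_sum
      intro r _
      have := (((hx.const_mul (sr r)).neg.cexp).const_sub 1).const_mul (A r)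
      refine HasDerivAt.congr_deriv this ?_
      simp only [Pi.neg_apply]
      ring
  let J : ℂ → ℝ → ℂ := fun s t =>
    ∫ x in (0:ℝ)..t, Complex.exp (-(s * (x:ℂ))) * SS δ δ₁ (t - x)
  have hSc := SS_cont δ δ₁
  have hB1' : ∀ t, B1 t * (((1 : ℝ) - H t : ℝ) : ℂ) =
      1 / (α:ℂ) * (J 0 t * SS δ δ₁ t) -
        ∑ r : Fin M, A r * sr r * (J (sr r) t * SS δ δ₁ t) := by
    intro t
    have : B1 t = 1 / (α:ℂ) * J 0 t - ∑ r : Fin M, A r * sr r * J (sr r) t := by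
      rw [hB1]
      simp only [J]
      simp_rw [← intervalIntegral.integral_const_mul]
      rw [← intervalIntegral.integral_finsetSum, ← intervalIntegral.integral_sub]
      · congr 1
        ext x
        rw [hderiv, hS, sub_mul, Finset.sum_mul]
        simp [mul_assoc]
      · apply Continuous.intervalIntegrable
        fun_prop
      · apply Continuous.intervalIntegrable
        fun_prop
      · intro r _
        apply Continuous.intervalIntegrable
        fun_prop
    rw [this, hS, sub_mul, Finset.sum_mul]
    simp only [mul_assoc]
  obtain ⟨i0, v0⟩ := aux_K δ δ₁ 0 hdc hec (by simp) hdec hdn.symm hen.symm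
  have hK := fun r => aux_K δ δ₁ (sr r) hdc hec (hre r).le hdec (hneδ r) (hneδ₁ r)
  have hI : ∫ t in Ioi (0 : ℝ), B1 t * (((1 : ℝ) - H t : ℝ) : ℂ) =
      1 / (α:ℂ) * (∫ t in Ioi (0 : ℝ), J 0 t * SS δ δ₁ t) -
        ∑ r : Fin M, A r * sr r * ∫ t in Ioi (0 : ℝ), J (sr r) t * SS δ δ₁ t := by
    simp_rw [hB1']
    rw [integral_sub (i0.const_mul _)
      (integrable_finsetSum _ (fun r _ => (hK r).1.const_mul (A r * sr r))),
      integral_finsetSum _ (fun r _ => (hK r).1.const_mul (A r * sr r))]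
    simp only [J, integral_const_mul]
  rw [hFF, hB2s, hI]
  simp only [J]
  rw [v0, Finset.sum_congr rfl (fun r _ => by rw [(hK r).2]), hB]
  have e1 : ∀ X : ℂ, 1 + 2 * (1 / (α:ℂ) * (1 / (α:ℂ) * ((δ + δ₁) / (δ * δ₁) * ((δ + δ₁) ^ 3 + 0 * ((δ:ℂ) ^ 2 + 3 * δ * δ₁ + δ₁ ^ 2)) /
        (2 * (((δ:ℂ) + δ₁) ^ 2 * (δ + 0) * (δ₁ + 0)))) - X)) / ((1 / α * (1 / δ + 1 / δ₁) : ℝ) : ℂ)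
        - ((1 / α * (1 / δ + 1 / δ₁) : ℝ) : ℂ) = 1 - (2 * (δ * δ₁) / (δ + δ₁)) * X := by
    intro X
    have e2 : ((1 / α * (1 / δ + 1 / δ₁) : ℝ) : ℂ) = ((δ:ℂ) + δ₁) / (α * δ * δ₁) := by
      push_cast
      field_simp
      ring
    rw [e2]
    simp only [zero_mul, add_zero]
    field_simp
    ring
  rw [e1, Finset.mul_sum]
  congr 1
  apply Finset.sum_congr rfl
  intro r _
  have n1 : (δ:ℂ) + sr r ≠ 0 := by
    intro h
    have := congrArg Complex.re h
    simp at this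
    linarith [hre r]
  have n2 : (δ₁:ℂ) + sr r ≠ 0 := by
    intro h
    have := congrArg Complex.re h
    simp at this
    linarith [hre r]
  field_simp
end

section
/- Fix integers G ≥ 2 and R ≥ 1 and positive reals k_on, k_1, …, k_G, and regard FF^C(R, k_off) as a function of k_off on [0, ∞). Define k_1^* = e_{G−1}(k_2,…,k_G) e_{G−2}(k_2,…,k_G)/e_{G−2}(k_2²,…,k_G²), k_on,1^* = e_{G−1}(k_2,…,k_G)/e_{G−2}(k_2,…,k_G), k_on,2^* = e_{G−1}(k_2,…,k_G) e_{G−1}(k_1,…,k_G)/(k_1 e_{G−2}(k_2²,…,k_G²) − e_{G−1}(k_2,…,k_G) e_{G−2}(k_2,…,k_G)), and k_off,1 = [k_on e_{G−1}(k_2,…,k_G) e_{G−1}(k_1,…,k_G) − k_on² k_1 e_{G−2}(k_2²,…,k_G²) + k_on² e_{G−1}(k_2,…,k_G) e_{G−2}(k_2,…,k_G)] / [e_{G−1}(k_2,…,k_G)(e_{G−1}(k_2,…,k_G) − k_on e_{G−2}(k_2,…,k_G))]. Then: (Case 1) if k_1 > k_1^* and k_on > k_on,2^*, then k_off,1 >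 0, FF^C(R, ·) is strictly decreasing on [0, k_off,1] and strictly increasing on [k_off,1, ∞), FF^C(R, k_off) < 1 for all k_off ≥ 0, and FF^C(R, k_off) → 1 as k_off → ∞; (Case 2) if either (k_1 ≤ k_1^* and k_on ≥ k_on,1^*) or (k_1 > k_1^* and k_on,1^* ≤ k_on ≤ k_on,2^*), then FF^C(R, ·) is strictly increasing on [0, ∞), FF^C(R, k_off) < 1 for all k_off ≥ 0, and FF^C(R, k_off) → 1 as k_off → ∞; (Case 3) if k_on < k_on,1^*, then k_off,1 > 0, FF^C(R, ·) is strictly increasing on [0, k_off,1] and strictly decreasing on [k_off,1, ∞), and FF^C(R, k_off) → 1 as k_off → ∞ with FF^C(R, k_off) > 1 for all sufficiently large k_off. -/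
open Filter

/-- Elementary symmetric polynomial of (integer) degree `g` in the variables
`x i` for `i ∈ s`, with the conventions `e_0 = 1` and `e_g = 0` for `g < 0`
or `g > card s`. -/
noncomputable def esymm (x : ℕ → ℝ) (s : Finset ℕ) (g : ℤ) : ℝ :=
  if 0 ≤ g then ∑ t ∈ s.powersetCard g.toNat, ∏ i ∈ t, x i else 0

/-- Double factorial: `dfact n = n!! = n(n−2)(n−4)⋯`, with `0!! = 1!! = 1`. -/
def dfact : ℕ → ℕ
  | 0 => 1
  | 1 => 1
  | n + 2 => (n + 2) * dfact n

/-- Fano factor of total cytoplasmic mRNA from the slow-scale linear noise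
approximation, with `R` cytoplasmic processing steps. -/
noncomputable def FFC (G : ℕ) (k : ℕ → ℝ) (kon koff : ℝ) (R : ℕ) : ℝ :=
  1 + 2 * esymm k (Finset.Icc 1 G) (G : ℤ) *
      (1 - (dfact (2 * R - 1) : ℝ) / (dfact (2 * R) : ℝ)) *
      (koff * esymm k (Finset.Icc 2 G) ((G : ℤ) - 1)
        - kon * koff * esymm k (Finset.Icc 2 G) ((G : ℤ) - 2)
        - kon ^ 2 * esymm k (Finset.Icc 1 G) ((G : ℤ) - 2)) /
      (koff * esymm k (Finset.Icc 2 G) ((G : ℤ) - 1)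
        + kon * esymm k (Finset.Icc 1 G) ((G : ℤ) - 1)) ^ 2

lemma aux_rec (x : ℕ → ℝ) (s : Finset ℕ) (a : ℕ) (ha : a ∉ s) (g : ℤ) :
    esymm x (insert a s) g = esymm x s g + x a * esymm x s (g - 1) := by
  unfold esymm
  by_cases hg : 0 ≤ g
  · obtain ⟨n, rfl⟩ := Int.eq_ofNat_of_zero_le hg
    cases n with
    | zero => simp
    | succ n =>
      have h1 : ((n + 1 : ℕ) : ℤ) - 1 = (n : ℤ) := by push_cast; ring
      rw [h1]
      simp only [Int.natCast_nonneg, if_true, Int.toNat_natCast]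
      rw [Finset.powersetCard_succ_insert ha, Finset.sum_union]
      · congr 1
        rw [Finset.sum_image, Finset.mul_sum]
        · apply Finset.sum_congr rfl
          intro t ht
          have hts := (Finset.mem_powersetCard.mp ht).1
          rw [Finset.prod_insert (fun h => ha (hts h))]
        · intro t ht u hu htu
          have hts := (Finset.mem_powersetCard.mp ht).1
          have hus := (Finset.mem_powersetCard.mp hu).1
          have e1 := Finset.erase_insert (fun h => ha (hts h))
          have e2 := Finset.erase_insert (fun h => ha (hus h))
          rw [← e1, ← e2]
          exact congrArg (fun z => Finset.erase z a) htu
      · rw [Finset.disjoint_left]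
        intro t ht htu
        obtain ⟨u, hu, rfl⟩ := Finset.mem_image.mp htu
        exact ha ((Finset.mem_powersetCard.mp ht).1 (Finset.mem_insert_self a u))
  · have h2 : ¬ (0 ≤ g - 1) := by omega
    rw [if_neg hg, if_neg hg, if_neg h2]; simp

lemma aux_card (x : ℕ → ℝ) (s : Finset ℕ) (g : ℤ) (h : g = s.card) :
    esymm x s g = ∏ i ∈ s, x i := by
  subst h
  simp [esymm]

lemma aux_nonneg (x : ℕ → ℝ) (s : Finset ℕ) (hx : ∀ i ∈ s, 0 < x i) (g : ℤ) :
    0 ≤ esymm x s g := by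
  unfold esymm
  split_ifs
  · exact Finset.sum_nonneg fun t ht => Finset.prod_nonneg fun i hi =>
      (hx i ((Finset.mem_powersetCard.mp ht).1 hi)).le
  · exact le_rfl

lemma aux_pos (x : ℕ → ℝ) (s : Finset ℕ) (hx : ∀ i ∈ s, 0 < x i) (g : ℤ)
    (h0 : 0 ≤ g) (h1 : g ≤ s.card) : 0 < esymm x s g := by
  unfold esymm
  rw [if_pos h0]
  refine Finset.sum_pos (fun t ht => Finset.prod_pos fun i hi =>
      (hx i ((Finset.mem_powersetCard.mp ht).1 hi))) ?_
  rw [Finset.powersetCard_nonempty]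
  omega

lemma aux_sq (x : ℕ → ℝ) (s : Finset ℕ) :
    (esymm x s ((s.card : ℤ) - 1)) ^ 2 =
      esymm (fun i => (x i) ^ 2) s ((s.card : ℤ) - 1) +
        2 * (∏ i ∈ s, x i) * esymm x s ((s.card : ℤ) - 2) := by
  induction s using Finset.induction_on with
  | empty => simp [esymm]
  | insert a s ha ih =>
    rw [aux_rec _ _ _ ha, aux_rec _ _ _ ha, aux_rec _ _ _ ha, Finset.prod_insert ha,
      Finset.card_insert_of_notMem ha]
    have e1 : ((s.card + 1 : ℕ) : ℤ) - 1 = s.card := by push_cast; ring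
    have e2 : ((s.card + 1 : ℕ) : ℤ) - 2 = (s.card : ℤ) - 1 := by push_cast; ring
    have e3 : (s.card : ℤ) - 1 - 1 = (s.card : ℤ) - 2 := by ring
    rw [e1, e2, e3, aux_card x s _ rfl, aux_card _ s _ rfl, Finset.prod_pow]
    linear_combination (x a) ^ 2 * ih

lemma aux_dfact_pos : ∀ n, 0 < dfact n
  | 0 => by simp [dfact]
  | 1 => by simp [dfact]
  | n + 2 => by
    have := aux_dfact_pos n
    simp only [dfact]; positivity

lemma aux_dfact (r : ℕ) : dfact (2 * r + 1) < dfact (2 * r + 2) := by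
  induction r with
  | zero => simp [dfact]
  | succ r ih =>
    have e1 : 2 * (r + 1) + 1 = (2 * r + 1) + 2 := by ring
    have e2 : 2 * (r + 1) + 2 = (2 * r + 2) + 2 := by ring
    rw [e1, e2, dfact, dfact]
    have := aux_dfact_pos (2 * r + 2)
    nlinarith

lemma aux_lt (c P al b ga x y : ℝ) (hc : 0 < c) (hx : 0 < x * P + ga) (hy : 0 < y * P + ga)
    (hxy : x < y)
    (h : 0 < (-al * P * x + (al * ga + 2 * P * b)) * (y * P + ga) +
      (-al * P * y + (al * ga + 2 * P * b)) * (x * P + ga)) :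
    1 + c * (al * x - b) / (x * P + ga) ^ 2 < 1 + c * (al * y - b) / (y * P + ga) ^ 2 := by
  have : c * (al * y - b) / (y * P + ga) ^ 2 - c * (al * x - b) / (x * P + ga) ^ 2 =
      c * (y - x) * ((-al * P * x + (al * ga + 2 * P * b)) * (y * P + ga) +
      (-al * P * y + (al * ga + 2 * P * b)) * (x * P + ga)) /
        (2 * (x * P + ga) ^ 2 * (y * P + ga) ^ 2) := by
    have hx0 := hx.ne'
    have hy0 := hy.ne'
    rw [div_sub_div _ _ (pow_ne_zero 2 hy0) (pow_ne_zero 2 hx0),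
      div_eq_div_iff (by positivity) (by positivity)]
    ring
  have h2 : 0 < c * (y - x) * ((-al * P * x + (al * ga + 2 * P * b)) * (y * P + ga) +
      (-al * P * y + (al * ga + 2 * P * b)) * (x * P + ga)) /
        (2 * (x * P + ga) ^ 2 * (y * P + ga) ^ 2) := by
    have := sub_pos.mpr hxy
    positivity
  linarith

lemma aux_gt (c P al b ga x y : ℝ) (hc : 0 < c) (hx : 0 < x * P + ga) (hy : 0 < y * P + ga)
    (hxy : x < y)
    (h : (-al * P * x + (al * ga + 2 * P * b)) * (y * P + ga) +
      (-al * P * y + (al * ga + 2 * P * b)) * (x * P + ga) < 0) :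
    1 + c * (al * y - b) / (y * P + ga) ^ 2 < 1 + c * (al * x - b) / (x * P + ga) ^ 2 := by
  have := aux_lt c P (-al) (-b) ga x y hc hx hy hxy (by linarith)
  have e : ∀ z, 1 + c * (-al * z - -b) / (z * P + ga) ^ 2 =
    1 - c * (al * z - b) / (z * P + ga) ^ 2 := by intro z; ring
  rw [e, e] at this
  linarith

lemma aux_tendsto (c P al b ga : ℝ) (hP : 0 < P) :
    Tendsto (fun x : ℝ => 1 + c * (al * x - b) / (x * P + ga) ^ 2) atTop (nhds 1) := by
  have hD : Tendsto (fun x : ℝ => x * P + ga) atTop atTop :=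
    tendsto_atTop_add_const_right _ _ (tendsto_id.atTop_mul_const hP)
  have hI := hD.inv_tendsto_atTop
  have h := ((hI.const_mul (c * al / P)).sub ((hI.mul hI).const_mul (c * (al * ga / P + b)))).const_add 1
  simp only [mul_zero, sub_zero, add_zero] at h
  refine h.congr' ?_
  filter_upwards [hD.eventually_gt_atTop 0] with x hx
  simp only [Pi.inv_apply]
  field_simp
  ring

lemma aux_main (f : ℝ → ℝ) (c P Q S T k1 A B kon k1s kon1s kon2s koff1 : ℝ) (hc : 0 < c)
    (hP : 0 < P) (hQ : 0 < Q) (hS : 0 < S) (hT : 0 ≤ T) (hk1 : 0 < k1) (hkon : 0 < kon)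
    (hA : A = P + k1 * Q) (hB : B = Q + k1 * T) (hid : Q ^ 2 = S + 2 * P * T)
    (hf : ∀ x, f x = 1 + c * ((P - kon * Q) * x - kon ^ 2 * B) / (x * P + kon * A) ^ 2)
    (hk1s : k1s = P * Q / S) (hkon1s : kon1s = P / Q)
    (hkon2s : kon2s = P * A / (k1 * S - P * Q))
    (hkoff1 : koff1 = (kon * P * A - kon ^ 2 * k1 * S + kon ^ 2 * P * Q) /
      (P * (P - kon * Q))) :
    ((k1s < k1 ∧ kon2s < kon) →
      0 < koff1 ∧ StrictAntiOn f (Set.Icc 0 koff1) ∧ StrictMonoOn f (Set.Ici koff1) ∧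
      (∀ koff : ℝ, 0 ≤ koff → f koff < 1) ∧ Tendsto f atTop (nhds 1)) ∧
    (((k1 ≤ k1s ∧ kon1s ≤ kon) ∨ (k1s < k1 ∧ kon1s ≤ kon ∧ kon ≤ kon2s)) →
      StrictMonoOn f (Set.Ici 0) ∧
      (∀ koff : ℝ, 0 ≤ koff → f koff < 1) ∧ Tendsto f atTop (nhds 1)) ∧
    (kon < kon1s →
      0 < koff1 ∧ StrictMonoOn f (Set.Icc 0 koff1) ∧ StrictAntiOn f (Set.Ici koff1) ∧
      Tendsto f atTop (nhds 1) ∧ (∀ᶠ koff : ℝ in atTop, 1 < f koff)) := by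
  have hApos : 0 < A := by rw [hA]; positivity
  have hBpos : 0 < B := by rw [hB]; positivity
  have hlim : Tendsto f atTop (nhds 1) := by
    have := aux_tendsto c P (P - kon * Q) (kon ^ 2 * B) (kon * A) hP
    exact this.congr fun x => (hf x).symm
  have hD : ∀ x, 0 ≤ x → 0 < x * P + kon * A := fun x hx => by positivity
  have hm : (P - kon * Q) * (kon * A) + 2 * P * (kon ^ 2 * B) =
      kon * P * A - kon ^ 2 * k1 * S + kon ^ 2 * P * Q := by
    rw [hA, hB]; linear_combination (-kon ^ 2 * k1) * hid
  have hlt1 : P - kon * Q ≤ 0 → ∀ x : ℝ, 0 ≤ x → f x < 1 := by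
    intro ha x hx
    rw [hf]
    have h1 : (P - kon * Q) * x - kon ^ 2 * B < 0 := by
      have : 0 < kon ^ 2 * B := by positivity
      nlinarith [mul_nonneg (neg_nonneg.mpr ha) hx]
    have h2 : c * ((P - kon * Q) * x - kon ^ 2 * B) / (x * P + kon * A) ^ 2 < 0 :=
      div_neg_of_neg_of_pos (mul_neg_of_pos_of_neg hc h1) (pow_pos (hD x hx) 2)
    linarith
  set al := P - kon * Q with hal
  set m := kon * P * A - kon ^ 2 * k1 * S + kon ^ 2 * P * Q with hmd
  have hroot : al ≠ 0 → m = al * P * koff1 := by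
    intro h; rw [hkoff1]; field_simp
  have up : ∀ x y, 0 ≤ x → x < y → 0 ≤ -al * P * x + m → 0 ≤ -al * P * y + m →
      (0 < -al * P * x + m ∨ 0 < -al * P * y + m) → f x < f y := by
    intro x y hx hxy h1 h2 h3
    rw [hf, hf]
    have hdx := hD x hx
    have hdy := hD y (by linarith)
    refine aux_lt c P al _ _ x y hc hdx hdy hxy ?_
    rw [hm]
    rcases h3 with h3 | h3
    · have := mul_pos h3 hdy
      have := mul_nonneg h2 hdx.le
      linarith
    · have := mul_pos h3 hdx
      have := mul_nonneg h1 hdy.le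
      linarith
  have down : ∀ x y, 0 ≤ x → x < y → -al * P * x + m ≤ 0 → -al * P * y + m ≤ 0 →
      (-al * P * x + m < 0 ∨ -al * P * y + m < 0) → f y < f x := by
    intro x y hx hxy h1 h2 h3
    rw [hf, hf]
    have hdx := hD x hx
    have hdy := hD y (by linarith)
    refine aux_gt c P al _ _ x y hc hdx hdy hxy ?_
    rw [hm]
    rcases h3 with h3 | h3
    · have := mul_pos (neg_pos.mpr h3) hdy
      have := mul_nonneg (neg_nonneg.mpr h2) hdx.le
      linarith
    · have := mul_pos (neg_pos.mpr h3) hdx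
      have := mul_nonneg (neg_nonneg.mpr h1) hdy.le
      linarith
  refine ⟨?_, ?_, ?_⟩
  · rintro ⟨h1, h2⟩
    rw [hk1s, div_lt_iff₀ hS] at h1
    have hden : 0 < k1 * S - P * Q := by linarith
    rw [hkon2s, div_lt_iff₀ hden] at h2
    have hmneg : m < 0 := by
      have : m = kon * (P * A - kon * (k1 * S - P * Q)) := by rw [hmd]; ring
      rw [this]; exact mul_neg_of_pos_of_neg hkon (by linarith)
    have halneg : al < 0 := by
      have hb : 0 < 2 * P * (kon ^ 2 * B) := by positivity
      have h3 : al * (kon * A) < 0 := by linarith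
      by_contra h
      have : 0 ≤ al * (kon * A) := mul_nonneg (not_lt.mp h) (by positivity)
      linarith
    have hr := hroot halneg.ne
    have hap : 0 < -al * P := mul_pos (neg_pos.mpr halneg) hP
    have hk0 : 0 < koff1 := by
      rw [hkoff1]; exact div_pos_of_neg_of_neg hmneg (mul_neg_of_pos_of_neg hP halneg)
    have hh : ∀ x, -al * P * x + m = (-al * P) * (x - koff1) := fun x => by rw [hr]; ring
    refine ⟨hk0, ?_, ?_, hlt1 halneg.le, hlim⟩
    · rintro x ⟨hx, hx'⟩ y ⟨hy, hy'⟩ hxy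
      refine down x y hx hxy ?_ ?_ (Or.inl ?_) <;> rw [hh]
      · exact mul_nonpos_of_nonneg_of_nonpos hap.le (by linarith)
      · exact mul_nonpos_of_nonneg_of_nonpos hap.le (by linarith)
      · exact mul_neg_of_pos_of_neg hap (by linarith)
    · intro x hx y hy hxy
      have hx : koff1 ≤ x := hx
      refine up x y (by linarith) hxy ?_ ?_ (Or.inr ?_) <;> rw [hh]
      · exact mul_nonneg hap.le (by linarith)
      · exact mul_nonneg hap.le (by linarith)
      · exact mul_pos hap (by linarith)
  · intro h
    have hk1' : kon1s ≤ kon := by rcases h with h | h; exacts [h.2, h.2.1]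
    rw [hkon1s, div_le_iff₀ hQ] at hk1'
    have hal0 : al ≤ 0 := by linarith
    have hm0 : 0 ≤ m := by
      have e : m = kon * (P * A - kon * (k1 * S - P * Q)) := by rw [hmd]; ring
      rw [e]
      apply mul_nonneg hkon.le
      rcases h with ⟨h, -⟩ | ⟨h, -, h'⟩
      · rw [hk1s, le_div_iff₀ hS] at h
        have : 0 ≤ kon * (P * Q - k1 * S) := mul_nonneg hkon.le (by linarith)
        have : 0 < P * A := by positivity
        linarith
      · rw [hk1s, div_lt_iff₀ hS] at h
        rw [hkon2s, le_div_iff₀ (by linarith)] at h'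
        linarith
    refine ⟨?_, hlt1 hal0, hlim⟩
    have hap : 0 ≤ -al * P := mul_nonneg (neg_nonneg.mpr hal0) hP.le
    intro x hx y hy hxy
    have hx : 0 ≤ x := hx
    have hy : 0 ≤ y := hy
    refine up x y hx hxy ?_ ?_ (Or.inr ?_)
    · have := mul_nonneg hap hx; linarith
    · have := mul_nonneg hap hy; linarith
    · rcases hal0.lt_or_eq with h0 | h0
      · have : 0 < -al * P * y := mul_pos (mul_pos (neg_pos.mpr h0) hP) (by linarith)
        linarith
      · rw [h0] at hm ⊢
        have hb : 0 < 2 * P * (kon ^ 2 * B) := by positivity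
        linarith
  · intro h
    rw [hkon1s, lt_div_iff₀ hQ] at h
    have halp : 0 < al := by linarith
    have hmp : 0 < m := by rw [← hm]; positivity
    have hr := hroot halp.ne'
    have hap : 0 < al * P := mul_pos halp hP
    have hk0 : 0 < koff1 := by
      rw [hkoff1]; exact div_pos hmp (mul_pos hP halp)
    have hh : ∀ x, -al * P * x + m = (al * P) * (koff1 - x) := fun x => by rw [hr]; ring
    refine ⟨hk0, ?_, ?_, hlim, ?_⟩
    · rintro x ⟨hx, hx'⟩ y ⟨hy, hy'⟩ hxy
      refine up x y hx hxy ?_ ?_ (Or.inl ?_) <;> rw [hh]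
      · exact mul_nonneg hap.le (by linarith)
      · exact mul_nonneg hap.le (by linarith)
      · exact mul_pos hap (by linarith)
    · intro x hx y hy hxy
      have hx : koff1 ≤ x := hx
      refine down x y (by linarith) hxy ?_ ?_ (Or.inr ?_) <;> rw [hh]
      · exact mul_nonpos_of_nonneg_of_nonpos hap.le (by linarith)
      · exact mul_nonpos_of_nonneg_of_nonpos hap.le (by linarith)
      · exact mul_neg_of_pos_of_neg hap (by linarith)
    · filter_upwards [eventually_gt_atTop (kon ^ 2 * B / al), eventually_ge_atTop 0] with x hx hx0
      rw [div_lt_iff₀ halp] at hx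
      rw [hf]
      have : 0 < c * (al * x - kon ^ 2 * B) / (x * P + kon * A) ^ 2 :=
        div_pos (mul_pos hc (by linarith)) (pow_pos (hD x hx0) 2)
      linarith

/-- the three types of behaviour of the cytoplasmic mRNA Fano
factor as a function of the deactivation rate `koff`. -/
theorem FFC_three_cases_in_koff
    (G R : ℕ) (hG : 2 ≤ G) (hR : 1 ≤ R)
    (kon : ℝ) (k : ℕ → ℝ) (hkon : 0 < kon)
    (hk : ∀ i ∈ Finset.Icc 1 G, 0 < k i)
    (k1s kon1s kon2s koff1 : ℝ)
    (hk1s : k1s = esymm k (Finset.Icc 2 G) ((G : ℤ) - 1) *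
      esymm k (Finset.Icc 2 G) ((G : ℤ) - 2) /
      esymm (fun i => (k i) ^ 2) (Finset.Icc 2 G) ((G : ℤ) - 2))
    (hkon1s : kon1s = esymm k (Finset.Icc 2 G) ((G : ℤ) - 1) /
      esymm k (Finset.Icc 2 G) ((G : ℤ) - 2))
    (hkon2s : kon2s = esymm k (Finset.Icc 2 G) ((G : ℤ) - 1) *
      esymm k (Finset.Icc 1 G) ((G : ℤ) - 1) /
      (k 1 * esymm (fun i => (k i) ^ 2) (Finset.Icc 2 G) ((G : ℤ) - 2)
        - esymm k (Finset.Icc 2 G) ((G : ℤ) - 1) *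
          esymm k (Finset.Icc 2 G) ((G : ℤ) - 2)))
    (hkoff1 : koff1 =
      (kon * esymm k (Finset.Icc 2 G) ((G : ℤ) - 1) *
          esymm k (Finset.Icc 1 G) ((G : ℤ) - 1)
        - kon ^ 2 * k 1 * esymm (fun i => (k i) ^ 2) (Finset.Icc 2 G) ((G : ℤ) - 2)
        + kon ^ 2 * esymm k (Finset.Icc 2 G) ((G : ℤ) - 1) *
          esymm k (Finset.Icc 2 G) ((G : ℤ) - 2)) /
      (esymm k (Finset.Icc 2 G) ((G : ℤ) - 1) *
        (esymm k (Finset.Icc 2 G) ((G : ℤ) - 1)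
          - kon * esymm k (Finset.Icc 2 G) ((G : ℤ) - 2)))) :
    -- Case 1
    ((k1s < k 1 ∧ kon2s < kon) →
      0 < koff1 ∧
      StrictAntiOn (fun koff => FFC G k kon koff R) (Set.Icc 0 koff1) ∧
      StrictMonoOn (fun koff => FFC G k kon koff R) (Set.Ici koff1) ∧
      (∀ koff : ℝ, 0 ≤ koff → FFC G k kon koff R < 1) ∧
      Tendsto (fun koff => FFC G k kon koff R) atTop (nhds 1)) ∧
    -- Case 2
    (((k 1 ≤ k1s ∧ kon1s ≤ kon) ∨ (k1s < k 1 ∧ kon1s ≤ kon ∧ kon ≤ kon2s)) →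
      StrictMonoOn (fun koff => FFC G k kon koff R) (Set.Ici 0) ∧
      (∀ koff : ℝ, 0 ≤ koff → FFC G k kon koff R < 1) ∧
      Tendsto (fun koff => FFC G k kon koff R) atTop (nhds 1)) ∧
    -- Case 3
    (kon < kon1s →
      0 < koff1 ∧
      StrictMonoOn (fun koff => FFC G k kon koff R) (Set.Icc 0 koff1) ∧
      StrictAntiOn (fun koff => FFC G k kon koff R) (Set.Ici koff1) ∧
      Tendsto (fun koff => FFC G k kon koff R) atTop (nhds 1) ∧
      (∀ᶠ koff : ℝ in atTop, 1 < FFC G k kon koff R)) := by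
  have hins : Finset.Icc 1 G = insert 1 (Finset.Icc 2 G) := by
    ext i; simp only [Finset.mem_Icc, Finset.mem_insert]; omega
  have hni : (1 : ℕ) ∉ Finset.Icc 2 G := by simp
  have hcard : ((Finset.Icc 2 G).card : ℤ) = (G : ℤ) - 1 := by
    rw [Nat.card_Icc]; omega
  have hk2 : ∀ i ∈ Finset.Icc 2 G, 0 < k i := fun i hi => hk i (by rw [hins]; simp [hi])
  have hk2' : ∀ i ∈ Finset.Icc 2 G, 0 < (fun i => (k i) ^ 2) i := fun i hi => by
    have := hk2 i hi
    positivity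
  have hG' : (2 : ℤ) ≤ G := by exact_mod_cast hG
  have hrat : 0 < 1 - (dfact (2 * R - 1) : ℝ) / (dfact (2 * R) : ℝ) := by
    obtain ⟨r, rfl⟩ : ∃ r, R = r + 1 := ⟨R - 1, by omega⟩
    have e1 : 2 * (r + 1) - 1 = 2 * r + 1 := by omega
    have e2 : 2 * (r + 1) = 2 * r + 2 := by ring
    rw [e1, e2, sub_pos, div_lt_one (by exact_mod_cast aux_dfact_pos _)]
    exact_mod_cast aux_dfact r
  have hEG : 0 < esymm k (Finset.Icc 1 G) (G : ℤ) := by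
    refine aux_pos _ _ hk _ (by omega) ?_
    rw [Nat.card_Icc]; omega
  refine aux_main (fun koff => FFC G k kon koff R)
    (2 * esymm k (Finset.Icc 1 G) (G : ℤ) *
      (1 - (dfact (2 * R - 1) : ℝ) / (dfact (2 * R) : ℝ)))
    (esymm k (Finset.Icc 2 G) ((G : ℤ) - 1))
    (esymm k (Finset.Icc 2 G) ((G : ℤ) - 2))
    (esymm (fun i => (k i) ^ 2) (Finset.Icc 2 G) ((G : ℤ) - 2))
    (esymm k (Finset.Icc 2 G) ((G : ℤ) - 3)) (k 1)
    (esymm k (Finset.Icc 1 G) ((G : ℤ) - 1))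
    (esymm k (Finset.Icc 1 G) ((G : ℤ) - 2)) kon k1s kon1s kon2s koff1
    (by positivity)
    (aux_pos _ _ hk2 _ (by omega) (by omega))
    (aux_pos _ _ hk2 _ (by omega) (by omega))
    (aux_pos _ _ hk2' _ (by omega) (by omega))
    (aux_nonneg _ _ hk2 _)
    (hk 1 (by simp; omega)) hkon ?_ ?_ ?_ ?_ hk1s hkon1s hkon2s hkoff1
  · rw [hins, aux_rec _ _ _ hni]; ring_nf
  · rw [hins, aux_rec _ _ _ hni]; ring_nf
  · have h := aux_sq k (Finset.Icc 2 G)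
    rw [← aux_card k (Finset.Icc 2 G) _ rfl, hcard] at h
    have e1 : (G : ℤ) - 1 - 1 = G - 2 := by ring
    have e2 : (G : ℤ) - 1 - 2 = G - 3 := by ring
    rw [e1, e2] at h
    exact h
  · intro x
    simp only [FFC]
    ring
end
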